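/- arXiv:2210.00977 — 2 statements merged into one kernel-verified Lean document; each statement's English description precedes it below -/
import Mathlib

section
/- For any integer d ≥ 1, any integer k ≥ 1, and any real numbers x_1, ..., x_k, if h_{2d}(x_1, ..., x_k) = C(k+2d-1, 2d) · x̄^{2d} with x̄ = (x_1 + ⋯ + x_k)/k, then x_1 = x_2 = ⋯ = x_k. -/
/-- The complete homogeneous symmetric polynomial of degree `d` in `k` real variables. -/
noncomputable def hSym (k d : ℕ) (x : Fin k → ℝ) : ℝ :=
  ∑ ℓ ∈ Finset.Nat.antidiagonalTuple k d, ∏ i, x i ^ ℓ i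

/-- The geometric series `∑ aⁿ Xⁿ`. -/
noncomputable def gser (a : ℝ) : PowerSeries ℝ := PowerSeries.mk (fun n => a ^ n)

/-- Complete homogeneous symmetric polynomial of a multiset. -/
noncomputable def hM (n : ℕ) (s : Multiset ℝ) : ℝ := PowerSeries.coeff n (s.map gser).prod

lemma gser_mul (a : ℝ) : gser a * (1 - PowerSeries.C a * PowerSeries.X) = 1 := by
  ext n
  rw [mul_sub, mul_one, map_sub, ← mul_assoc]
  cases n with
  | zero => simp [gser]
  | succ n =>
    rw [PowerSeries.coeff_succ_mul_X, mul_comm (gser a), PowerSeries.coeff_C_mul]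
    simp [gser, PowerSeries.coeff_one, pow_succ']

lemma gser_diff (a b a' b' : ℝ) (h : a + b = a' + b') :
    gser a * gser b - gser a' * gser b' =
      PowerSeries.C (a' * b' - a * b) *
        (gser a * gser b * gser a' * gser b' * PowerSeries.X ^ 2) := by
  have hb : b' = a + b - a' := by linarith
  subst hb
  have h1 := gser_mul a
  have h2 := gser_mul b
  have h3 := gser_mul a'
  have h4 := gser_mul (a + b - a')
  generalize gser (a + b - a') = G4 at *
  generalize gser a = G1 at *
  generalize gser b = G2 at *
  generalize gser a' = G3 at *
  simp only [map_sub, map_add, map_mul] at *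
  generalize PowerSeries.C a = A at *
  generalize PowerSeries.C b = B at *
  generalize PowerSeries.C a' = D at *
  generalize (PowerSeries.X : PowerSeries ℝ) = X at *
  have e1 : (G1 * (1 - A * X)) * (G2 * (1 - B * X)) = 1 := by rw [h1, h2, one_mul]
  have e2 : (G3 * (1 - D * X)) * (G4 * (1 - (A + B - D) * X)) = 1 := by rw [h3, h4, one_mul]
  linear_combination (-(G1 * G2)) * e2 + (G3 * G4) * e1

lemma hM_diff (n : ℕ) (a b a' b' : ℝ) (h : a + b = a' + b') (s : Multiset ℝ) :
    hM (n + 2) (a ::ₘ b ::ₘ s) - hM (n + 2) (a' ::ₘ b' ::ₘ s) =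
      (a' * b' - a * b) * hM n (a ::ₘ b ::ₘ a' ::ₘ b' ::ₘ s) := by
  simp only [hM, Multiset.map_cons, Multiset.prod_cons]
  rw [← map_sub]
  have : gser a * (gser b * (s.map gser).prod) - gser a' * (gser b' * (s.map gser).prod)
      = PowerSeries.C (a' * b' - a * b) *
        ((gser a * (gser b * (gser a' * (gser b' * (s.map gser).prod)))) * PowerSeries.X ^ 2) := by
    linear_combination (s.map gser).prod * gser_diff a b a' b' h
  rw [this, PowerSeries.coeff_C_mul, PowerSeries.coeff_mul_X_pow]

lemma hM_replicate (n k : ℕ) (m : ℝ) :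
    hM n (Multiset.replicate (k + 1) m) = (Nat.choose (k + n) n : ℝ) * m ^ n := by
  have : gser m = PowerSeries.rescale m (PowerSeries.mk 1) := by
    ext n; simp [gser, PowerSeries.coeff_rescale]
  rw [hM, Multiset.map_replicate, Multiset.prod_replicate, this, ← map_pow,
    PowerSeries.mk_one_pow_eq_mk_choose_add, PowerSeries.coeff_rescale, PowerSeries.coeff_mk,
    Nat.choose_symm_add, mul_comm]

lemma hM_main (n : ℕ) (hpos : ∀ s : Multiset ℝ, (∃ x ∈ s, x ≠ 0) → 0 < hM n s) (m : ℝ) :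
    ∀ (c : ℕ) (s : Multiset ℝ) (j : ℕ), s.card = c → s.sum = s.card * m → (∃ x ∈ s, x ≠ m) →
      hM (n + 2) (Multiset.replicate (s.card + j) m) <
        hM (n + 2) (s + Multiset.replicate j m) := by
  intro c
  induction c with
  | zero =>
    intro s j hc _ ⟨x, hx, _⟩
    rw [Multiset.card_eq_zero] at hc
    simp [hc] at hx
  | succ c ih =>
    intro s j hc hs hex
    by_cases hm : m ∈ s
    · obtain ⟨t, rfl⟩ := Multiset.exists_cons_of_mem hm
      simp only [Multiset.card_cons, Multiset.sum_cons] at hc hs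
      push_cast at hs
      have hc' : t.card = c := by omega
      have := ih t (j + 1) hc' (by linarith) (by
        obtain ⟨x, hx, hne⟩ := hex
        rcases Multiset.mem_cons.1 hx with h | h
        · exact absurd h hne
        · exact ⟨x, h, hne⟩)
      rw [Multiset.replicate_succ, Multiset.add_cons] at this
      rw [Multiset.card_cons, Multiset.cons_add, add_assoc, add_comm 1 j]
      exact this
    · have hlt : ∃ a ∈ s, a < m := by
        by_contra! hcon
        have : (s.map (fun _ => m)).sum < (s.map id).sum := by
          apply Multiset.sum_lt_sum
          · intro i hi; exact hcon i hi
          · obtain ⟨x, hx, hne⟩ := hex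
            exact ⟨x, hx, lt_of_le_of_ne (hcon x hx) hne.symm⟩
        simp at this
        linarith
      have hgt : ∃ a ∈ s, m < a := by
        by_contra! hcon
        have : (s.map id).sum < (s.map (fun _ => m)).sum := by
          apply Multiset.sum_lt_sum
          · intro i hi; exact hcon i hi
          · obtain ⟨x, hx, hne⟩ := hex
            exact ⟨x, hx, lt_of_le_of_ne (hcon x hx) hne⟩
        simp at this
        linarith
      obtain ⟨a, ha, ham⟩ := hlt
      obtain ⟨b, hb, hbm⟩ := hgt
      obtain ⟨t, rfl⟩ := Multiset.exists_cons_of_mem ha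
      have hb' : b ∈ t := by
        rcases Multiset.mem_cons.1 hb with h | h
        · linarith
        · exact h
      obtain ⟨u, rfl⟩ := Multiset.exists_cons_of_mem hb'
      have hd := hM_diff n a b m (a + b - m) (by ring) (u + Multiset.replicate j m)
      have hp : 0 < hM n (a ::ₘ b ::ₘ m ::ₘ (a + b - m) ::ₘ (u + Multiset.replicate j m)) := by
        apply hpos
        by_cases h0 : a = 0
        · exact ⟨b, by simp, by linarith⟩
        · exact ⟨a, by simp, h0⟩
      have hq : 0 < m * (a + b - m) - a * b := by nlinarith
      have hlt := mul_pos hq hp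
      rw [← hd] at hlt
      simp only [Multiset.card_cons, Multiset.sum_cons] at hc hs
      push_cast at hs
      have hle : hM (n + 2) (Multiset.replicate ((u.card + 1) + (j + 1)) m) ≤
          hM (n + 2) (((a + b - m) ::ₘ u) + Multiset.replicate (j + 1) m) := by
        by_cases hall : ∃ x ∈ ((a + b - m) ::ₘ u), x ≠ m
        · have := ih ((a + b - m) ::ₘ u) (j + 1) (by simp; omega) (by simp; linarith) hall
          rw [Multiset.card_cons] at this
          exact this.le
        · push Not at hall
          have := Multiset.eq_replicate_of_mem hall
          rw [this, ← Multiset.replicate_add, Multiset.card_cons]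
      rw [Multiset.replicate_succ m j, Multiset.add_cons, Multiset.cons_add] at hle
      simp only [Multiset.card_cons, Multiset.cons_add]
      rw [show u.card + 1 + 1 + j = u.card + 1 + (j + 1) by ring]
      linarith

lemma hM_lt (n : ℕ) (hpos : ∀ s : Multiset ℝ, (∃ x ∈ s, x ≠ 0) → 0 < hM n s) (m : ℝ)
    (s : Multiset ℝ) (hs : s.sum = s.card * m) (hex : ∃ x ∈ s, x ≠ m) :
    hM (n + 2) (Multiset.replicate s.card m) < hM (n + 2) s := by
  simpa using hM_main n hpos m _ s 0 rfl hs hex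

lemma hM_pos (d : ℕ) : ∀ s : Multiset ℝ, (∃ x ∈ s, x ≠ 0) → 0 < hM (2 * d) s := by
  induction d with
  | zero =>
    intro s hs
    clear hs
    have : hM 0 s = 1 := by
      induction s using Multiset.induction with
      | empty => simp [hM]
      | cons a s ih =>
        simp only [hM, Multiset.map_cons, Multiset.prod_cons] at *
        rw [PowerSeries.coeff_mul]
        rw [PowerSeries.coeff_zero_eq_constantCoeff] at ih
        simp [gser, ih]
    simp [this]
  | succ d ih =>
    intro s hs
    obtain ⟨k, hk⟩ : ∃ k, s.card = k + 1 := by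
      obtain ⟨x, hx, _⟩ := hs
      exact ⟨s.card - 1, by have := Multiset.card_pos_iff_exists_mem.2 ⟨x, hx⟩; omega⟩
    have hk0 : ((k + 1 : ℕ) : ℝ) ≠ 0 := by positivity
    set m := s.sum / ((k + 1 : ℕ) : ℝ) with hm
    have hrep := hM_replicate (2 * d + 2) k m
    have hev : Even (2 * d + 2) := ⟨d + 1, by ring⟩
    by_cases hex : ∃ x ∈ s, x ≠ m
    · have := hM_lt (2 * d) ih m s (by rw [hk, hm]; field_simp) hex
      rw [hk, hrep] at this
      have h2 : 0 ≤ m ^ (2 * d + 2) := hev.pow_nonneg m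
      refine lt_of_le_of_lt ?_ this
      positivity
    · push Not at hex
      have hr := Multiset.eq_replicate_of_mem hex
      have hm0 : m ≠ 0 := by
        obtain ⟨x, hx, hne⟩ := hs
        rwa [← hex x hx]
      rw [hr, hk, show 2 * (d + 1) = 2 * d + 2 by ring, hrep]
      have h2 : 0 < m ^ (2 * d + 2) := hev.pow_pos hm0
      have h3 : 0 < Nat.choose (k + (2 * d + 2)) (2 * d + 2) := Nat.choose_pos (by omega)
      positivity

lemma hSym_eq (k n : ℕ) (x : Fin k → ℝ) :
    hSym k n x = PowerSeries.coeff n (∏ i, gser (x i)) := by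
  rw [PowerSeries.coeff_prod, hSym]
  symm
  refine Finset.sum_bij' (fun f _ => (f : Fin k → ℕ)) (fun f _ => Finsupp.equivFunOnFinite.symm f)
    ?_ ?_ ?_ ?_ ?_
  · intro f hf
    simpa [Finset.Nat.mem_antidiagonalTuple, Finset.mem_finsuppAntidiag] using hf
  · intro f hf
    simpa [Finset.Nat.mem_antidiagonalTuple, Finset.mem_finsuppAntidiag] using hf
  · intro f _; ext i; simp
  · intro f _; ext i; simp
  · intro f _; simp [gser]

/-- Equality case: if `h_{2d}(x) = C(k+2d-1, 2d) x̄^{2d}`, then all `x_i` are equal. -/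
theorem hSym_even_eq_iff (d k : ℕ) (hd : 1 ≤ d) (hk : 1 ≤ k) (x : Fin k → ℝ)
    (heq : hSym k (2 * d) x =
      (Nat.choose (k + 2 * d - 1) (2 * d) : ℝ) * ((∑ i, x i) / k) ^ (2 * d)) :
    ∀ i j : Fin k, x i = x j := by
  obtain ⟨d, rfl⟩ : ∃ e, d = e + 1 := ⟨d - 1, by omega⟩
  obtain ⟨k, rfl⟩ : ∃ e, k = e + 1 := ⟨k - 1, by omega⟩
  set m := (∑ i, x i) / ((k + 1 : ℕ) : ℝ) with hm
  have hk0 : ((k + 1 : ℕ) : ℝ) ≠ 0 := by positivity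
  let s : Multiset ℝ := (Finset.univ : Finset (Fin (k + 1))).val.map x
  have hcard : s.card = k + 1 := by simp [s]
  have hsum : s.sum = ∑ i, x i := rfl
  have hh : hSym (k + 1) (2 * (d + 1)) x = hM (2 * d + 2) s := by
    rw [hSym_eq, hM]
    simp only [s, Multiset.map_map]
    rfl
  have hall : ¬ ∃ y ∈ s, y ≠ m := by
    intro hex
    have := hM_lt (2 * d) (hM_pos d) m s (by rw [hcard, hsum, hm]; field_simp) hex
    rw [hcard, hM_replicate, ← hh, heq, show k + 1 + 2 * (d + 1) - 1 = k + (2 * d + 2) by omega,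
      show 2 * (d + 1) = 2 * d + 2 by ring] at this
    exact lt_irrefl _ this
  push Not at hall
  have key : ∀ i, x i = m := fun i => hall _ (Multiset.mem_map_of_mem x (Finset.mem_univ i))
  intro i j
  rw [key i, key j]
end

section
/- Let (p_ℓ)_{ℓ≥0} be the moment sequence of a real random variable X with finitely many values, i.e., p_ℓ = E[X^ℓ]. Then for all integers m, d with 1 ≤ d ≤ m/2, Σ p_{ℓ_1} ⋯ p_{ℓ_{m-2d+1}} ≥ C(m, 2d) · p_1^{2d}, where the sum is over all nonnegative integer tuples (ℓ_1, ..., ℓ_{m-2d+1}) summing to 2d. -/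
open MeasureTheory in
/-- Moments of the exponential distribution. -/
lemma exp_moment (l : ℕ) :
    IntegrableOn (fun x : ℝ => Real.exp (-x) * x ^ l) (Set.Ioi 0) ∧
      ∫ x in Set.Ioi (0 : ℝ), Real.exp (-x) * x ^ l = (l.factorial : ℝ) := by
  have hl : (0 : ℝ) < (l : ℝ) + 1 := by positivity
  constructor
  · simpa using Real.GammaIntegral_convergent hl
  · have h := Real.Gamma_eq_integral hl
    rw [Real.Gamma_nat_eq_factorial] at h
    simpa using h.symm

/-- Tangent line inequality for even powers. -/
lemma even_pow_tangent (d : ℕ) (hd : 1 ≤ d) (u v : ℝ) :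
    v ^ (2 * d) + (2 * d : ℕ) * v ^ (2 * d - 1) * (u - v) ≤ u ^ (2 * d) := by
  have hk : 2 * d ≠ 0 := by omega
  have hk1 : 2 * d - 1 ≠ 0 := by omega
  by_cases hv : v = 0
  · subst hv
    simp only [zero_pow hk, zero_pow hk1]
    have : 0 ≤ u ^ (2 * d) := (even_two_mul d).pow_nonneg u
    simpa using this
  · have hb : ∀ a : ℝ, 1 + (2 * d : ℕ) * a ≤ (1 + a) ^ (2 * d) := by
      intro a
      by_cases ha : -2 ≤ a
      · exact one_add_mul_le_pow ha _
      · have h1 : 0 ≤ (1 + a) ^ (2 * d) := (even_two_mul d).pow_nonneg _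
        have h2 : (1 : ℝ) ≤ (2 * d : ℕ) := by exact_mod_cast (by omega : 1 ≤ 2 * d)
        push Not at ha
        nlinarith
    have hp : 0 ≤ v ^ (2 * d) := (even_two_mul d).pow_nonneg v
    have h := mul_le_mul_of_nonneg_left (hb ((u - v) / v)) hp
    rw [← mul_pow] at h
    have e1 : v * (1 + (u - v) / v) = u := by field_simp; ring
    rw [e1] at h
    have e2 : v ^ (2 * d) = v ^ (2 * d - 1) * v := by
      rw [← pow_succ]; congr 1; omega
    refine le_trans (le_of_eq ?_) h
    rw [e2]; field_simp

open MeasureTheory in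
lemma integrable_weighted (n : ℕ) (P : MvPolynomial (Fin n) ℝ) :
    Integrable (fun z : Fin n → ℝ => (∏ i, Real.exp (-z i)) * MvPolynomial.eval z P)
      (Measure.pi fun _ => volume.restrict (Set.Ioi 0)) := by
  induction P using MvPolynomial.induction_on' with
  | monomial u a =>
    have h : Integrable (fun z : Fin n → ℝ => ∏ i, (Real.exp (-z i) * z i ^ u i))
        (Measure.pi fun _ => volume.restrict (Set.Ioi 0)) :=
      Integrable.fintype_prod (f := fun i (x : ℝ) => Real.exp (-x) * x ^ u i)
        fun i => (exp_moment (u i)).1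
    refine (h.const_mul a).congr (Filter.Eventually.of_forall fun z => ?_)
    simp only [MvPolynomial.eval_monomial, Finset.prod_mul_distrib]
    rw [Finsupp.prod_fintype _ _ (by simp)]
    ring
  | add p q hp hq =>
    refine (hp.add hq).congr (Filter.Eventually.of_forall fun z => ?_)
    simp [mul_add]

open MeasureTheory in
/-- Integral representation of complete homogeneous symmetric polynomials. -/
lemma integral_hsymm (n k : ℕ) (x : Fin n → ℝ) :
    ∫ z : Fin n → ℝ, (∏ i, Real.exp (-z i)) * (∑ i, x i * z i) ^ k
      ∂(Measure.pi fun _ => volume.restrict (Set.Ioi 0)) =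
    (k.factorial : ℝ) * ∑ l ∈ Finset.Nat.antidiagonalTuple n k, ∏ i, x i ^ l i := by
  have e : ∀ z : Fin n → ℝ, (∏ i, Real.exp (-z i)) * (∑ i, x i * z i) ^ k =
      ∑ l ∈ Finset.Nat.antidiagonalTuple n k,
        ((Nat.multinomial Finset.univ l : ℝ) * ∏ i, x i ^ l i) *
          ∏ i, (Real.exp (-z i) * z i ^ l i) := by
    intro z
    rw [Finset.sum_pow_eq_sum_piAntidiag, Finset.piAntidiag_univ_fin_eq_antidiagonalTuple,
      Finset.mul_sum]
    refine Finset.sum_congr rfl fun l _ => ?_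
    simp only [mul_pow, Finset.prod_mul_distrib]
    ring
  simp_rw [e]
  rw [integral_finset_sum]
  · rw [Finset.mul_sum]
    refine Finset.sum_congr rfl fun l hl => ?_
    rw [integral_const_mul,
      integral_fintype_prod_eq_prod (f := fun i (x : ℝ) => Real.exp (-x) * x ^ l i)]
    simp only [(exp_moment _).2]
    have h := Nat.multinomial_spec Finset.univ l
    rw [Finset.Nat.mem_antidiagonalTuple.1 hl] at h
    rw [← h]
    push_cast
    ring
  · intro l _
    exact (Integrable.fintype_prod (f := fun i (x : ℝ) => Real.exp (-x) * x ^ l i)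
      fun i => (exp_moment (l i)).1).const_mul _

open MeasureTheory in
/-- Supporting hyperplane of `h_{2d}` at a constant point. -/
lemma hsymm_tangent (n d : ℕ) (hd : 1 ≤ d) (a : ℝ) :
    ∃ c : Fin n → ℝ, ∀ x : Fin n → ℝ,
      (∑ l ∈ Finset.Nat.antidiagonalTuple n (2 * d), ∏ i, a ^ l i) + ∑ i, c i * (x i - a) ≤
        ∑ l ∈ Finset.Nat.antidiagonalTuple n (2 * d), ∏ i, x i ^ l i := by
  set ν : Measure (Fin n → ℝ) := Measure.pi fun _ => volume.restrict (Set.Ioi 0) with hν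
  set g : Fin n → (Fin n → ℝ) → ℝ := fun i z => (∏ i, Real.exp (-z i)) *
    ((2 * d : ℕ) * (∑ j, a * z j) ^ (2 * d - 1) * z i) with hg
  have hgi : ∀ i, Integrable (g i) ν := by
    intro i
    have := integrable_weighted n (MvPolynomial.C ((2 * d : ℕ) : ℝ) *
      (∑ j, MvPolynomial.C a * MvPolynomial.X j) ^ (2 * d - 1) * MvPolynomial.X i)
    simp only [map_mul, map_pow, map_sum, MvPolynomial.eval_C, MvPolynomial.eval_X] at this
    exact this
  have hpi : ∀ x : Fin n → ℝ, Integrable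
      (fun z => (∏ i, Real.exp (-z i)) * (∑ i, x i * z i) ^ (2 * d)) ν := by
    intro x
    have := integrable_weighted n
      ((∑ j, MvPolynomial.C (x j) * MvPolynomial.X j) ^ (2 * d))
    simp only [map_mul, map_pow, map_sum, MvPolynomial.eval_C, MvPolynomial.eval_X] at this
    exact this
  have hF : (0 : ℝ) < ((2 * d).factorial : ℝ) := by positivity
  refine ⟨fun i => (∫ z, g i z ∂ν) / ((2 * d).factorial : ℝ), fun x => ?_⟩
  have hs : Integrable (fun z => ∑ i, (x i - a) * g i z) ν :=
    integrable_finset_sum _ fun i _ => (hgi i).const_mul _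
  have hle : ∫ z, ((∏ i, Real.exp (-z i)) * (∑ i, a * z i) ^ (2 * d)
      + ∑ i, (x i - a) * g i z) ∂ν ≤
      ∫ z, (∏ i, Real.exp (-z i)) * (∑ i, x i * z i) ^ (2 * d) ∂ν := by
    refine integral_mono ((hpi fun _ => a).add hs) (hpi x) fun z => ?_
    have ht := even_pow_tangent d hd (∑ i, x i * z i) (∑ i, a * z i)
    have hD : 0 ≤ ∏ i, Real.exp (-z i) := Finset.prod_nonneg fun i _ => (Real.exp_pos _).le
    refine le_trans (le_of_eq ?_) (mul_le_mul_of_nonneg_left ht hD)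
    simp only [hg]
    rw [mul_add, ← Finset.sum_sub_distrib, Finset.mul_sum, Finset.mul_sum]
    congr 1
    refine Finset.sum_congr rfl fun i _ => ?_
    ring
  rw [integral_add (hpi fun _ => a) hs, integral_finset_sum _ fun i _ => (hgi i).const_mul _,
    integral_hsymm n _ x, integral_hsymm n _ (fun _ => a)] at hle
  simp only [integral_const_mul] at hle
  refine le_of_mul_le_mul_left (le_trans (le_of_eq ?_) hle) hF
  rw [mul_add, Finset.mul_sum (s := Finset.univ)]
  congr 1
  refine Finset.sum_congr rfl fun i _ => ?_
  field_simp

lemma card_antidiagonalTuple_aux (n k : ℕ) :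
    (Finset.Nat.antidiagonalTuple n k).card = (n + k - 1).choose k := by
  rw [← Finset.piAntidiag_univ_fin_eq_antidiagonalTuple, ← Finset.map_sym_eq_piAntidiag,
    Finset.card_map, Finset.sym_univ, Finset.card_univ, Sym.card_sym_eq_choose, Fintype.card_fin]

/-- For the moment sequence `p ℓ = E[X^ℓ]` of a finitely valued random variable `X`,
`Σ p_{ℓ_1} ⋯ p_{ℓ_{m-2d+1}} ≥ C(m, 2d) p_1^{2d}`, summing over nonnegative
integer tuples summing to `2d`. -/
theorem moment_sum_ge (N m d : ℕ) (hN : 1 ≤ N) (hd : 1 ≤ d) (hdm : 2 * d ≤ m)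
    (w X : Fin N → ℝ) (hw : ∀ i, 0 ≤ w i) (hw1 : ∑ i, w i = 1) :
    ∑ ℓ ∈ Finset.Nat.antidiagonalTuple (m - 2 * d + 1) (2 * d),
        ∏ i, (∑ j, w j * X j ^ ℓ i) ≥
      (Nat.choose m (2 * d) : ℝ) * (∑ j, w j * X j) ^ (2 * d) := by
  obtain ⟨n, hn⟩ : ∃ n, n = m - 2 * d + 1 := ⟨_, rfl⟩
  rw [← hn]
  set a : ℝ := ∑ j, w j * X j with ha
  obtain ⟨c, hc⟩ := hsymm_tangent n d hd a
  have hconst : (∑ l ∈ Finset.Nat.antidiagonalTuple n (2 * d), ∏ i, a ^ l i) =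
      (Nat.choose m (2 * d) : ℝ) * a ^ (2 * d) := by
    have h1 : ∀ l ∈ Finset.Nat.antidiagonalTuple n (2 * d), ∏ i, a ^ l i = a ^ (2 * d) := by
      intro l hl
      rw [Finset.prod_pow_eq_pow_sum, Finset.Nat.mem_antidiagonalTuple.1 hl]
    rw [Finset.sum_congr rfl h1, Finset.sum_const, card_antidiagonalTuple_aux, nsmul_eq_mul]
    congr 3
    omega
  have hL : ∑ l ∈ Finset.Nat.antidiagonalTuple n (2 * d), ∏ i, (∑ j, w j * X j ^ l i) =
      ∑ J : Fin n → Fin N, (∏ i, w (J i)) *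
        ∑ l ∈ Finset.Nat.antidiagonalTuple n (2 * d), ∏ i, X (J i) ^ l i := by
    simp_rw [Finset.prod_univ_sum, Fintype.piFinset_univ, Finset.mul_sum,
      Finset.prod_mul_distrib]
    rw [Finset.sum_comm]
  have hW : ∑ J : Fin n → Fin N, ∏ i, w (J i) = 1 := by
    have h := Finset.prod_univ_sum (fun _ : Fin n => (Finset.univ : Finset (Fin N)))
      (fun _ j => w j)
    rw [Fintype.piFinset_univ] at h
    rw [← h]
    simp [hw1]
  have hlin : ∀ i₀ : Fin n, ∑ J : Fin n → Fin N, (∏ i, w (J i)) * (X (J i₀) - a) = 0 := by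
    intro i₀
    have h := Finset.prod_univ_sum (fun _ : Fin n => (Finset.univ : Finset (Fin N)))
      (fun i j => w j * if i = i₀ then X j - a else 1)
    rw [Fintype.piFinset_univ] at h
    simp only [Finset.prod_mul_distrib, Finset.prod_ite_eq', Finset.mem_univ, if_true] at h
    rw [← h]
    refine Finset.prod_eq_zero (Finset.mem_univ i₀) ?_
    simp only [if_true, mul_sub, Finset.sum_sub_distrib, ← Finset.sum_mul, hw1]
    rw [← ha]; ring
  rw [ge_iff_le, hL, ← hconst]
  calc _ = ∑ J : Fin n → Fin N, (∏ i, w (J i)) *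
        ((∑ l ∈ Finset.Nat.antidiagonalTuple n (2 * d), ∏ i, a ^ l i)
          + ∑ i, c i * (X (J i) - a)) := by
        simp_rw [mul_add, Finset.sum_add_distrib]
        rw [← Finset.sum_mul, hW, one_mul]
        simp_rw [Finset.mul_sum]
        rw [Finset.sum_comm]
        rw [Finset.sum_eq_zero (s := Finset.univ), add_zero]
        intro i _
        have h := hlin i
        have h2 : ∑ J : Fin n → Fin N, (∏ i, w (J i)) * (c i * (X (J i) - a)) =
            c i * ∑ J : Fin n → Fin N, (∏ i, w (J i)) * (X (J i) - a) := by
          rw [Finset.mul_sum]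
          exact Finset.sum_congr rfl fun J _ => by ring
        rw [h2, h, mul_zero]
    _ ≤ _ := Finset.sum_le_sum fun J _ =>
        mul_le_mul_of_nonneg_left (hc fun i => X (J i)) (Finset.prod_nonneg fun i _ => hw _)
end
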